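/- arXiv:1206.3214 — 2 statements merged into one kernel-verified Lean document; each statement's English description precedes it below -/
import Mathlib

section
/- Let μ be a shift-invariant Borel probability measure on Σ_m and k ≥ 1. Then there exists a (k−1)-step Markov measure ν such that ν([a_1,…,a_k]) = μ([a_1,…,a_k]) for all cylinders [a_1,…,a_k] of length k, and h_ν ≥ h_μ. -/
open MeasureTheory Filter Topology
open scoped ENNReal NNReal

section Defs

variable {X : Type*} [MetricSpace X]

/-- The Bowen ball `B_n(x, ε)` for the dynamics `T`. -/
def bowenBall (T : X → X) (n : ℕ) (ε : ℝ) (x : X) : Set X :=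
  {y | ∀ j < n, dist (T^[j] x) (T^[j] y) < ε}

/-- `H^s_n(Z, ε)`: infimum of `∑ exp(-s n_i)` over countable covers of `Z` by Bowen balls
`B_{n_i}(x_i, ε)` with `n_i ≥ n`. -/
noncomputable def bowenHn (T : X → X) (Z : Set X) (s ε : ℝ) (n : ℕ) : ℝ≥0∞ :=
  ⨅ (c : ℕ → X × ℕ) (_ : Z ⊆ ⋃ i, bowenBall T (c i).2 ε (c i).1) (_ : ∀ i, n ≤ (c i).2),
    ∑' i, ENNReal.ofReal (Real.exp (-(s * ((c i).2 : ℝ))))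

/-- `H^s(Z, ε) = lim_n H^s_n(Z, ε)` (the quantities are nondecreasing in `n`). -/
noncomputable def bowenH (T : X → X) (Z : Set X) (s ε : ℝ) : ℝ≥0∞ :=
  ⨆ n : ℕ, bowenHn T Z s ε n

/-- `h_top(Z, ε)`: the critical value of `s ↦ H^s(Z, ε)`. -/
noncomputable def bowenEnt (T : X → X) (Z : Set X) (ε : ℝ) : ℝ≥0∞ :=
  ⨅ (s : ℝ≥0) (_ : bowenH T Z s ε = 0), (s : ℝ≥0∞)

/-- Bowen's topological entropy of an arbitrary subset `Z ⊆ X`: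
`h_top(Z) = lim_{ε → 0} h_top(Z, ε)`. -/
noncomputable def htop (T : X → X) (Z : Set X) : ℝ≥0∞ :=
  ⨆ (ε : ℝ) (_ : 0 < ε), bowenEnt T Z ε

variable [MeasurableSpace X]

/-- Shannon entropy of the finite measurable partition of `X` induced by `P : X → ι`. -/
noncomputable def partEntropy {ι : Type} [Fintype ι] (μ : Measure X) (P : X → ι) : ℝ :=
  ∑ i : ι, Real.negMulLog ((μ (P ⁻¹' {i})).toReal)

/-- The measure-theoretic (Kolmogorov–Sinai) entropy `h_μ(T)`: supremum over finite measurable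
partitions `P` of `lim_n (1/n) H_μ(P ∨ T⁻¹P ∨ ⋯ ∨ T^{-(n-1)}P)`, the limit being the
infimum by subadditivity. -/
noncomputable def hKS (T : X → X) (μ : Measure X) : ℝ≥0∞ :=
  ⨆ (k : ℕ) (P : X → Fin k) (_ : Measurable P),
    ENNReal.ofReal (⨅ n : ℕ,
      partEntropy μ (fun x => fun j : Fin (n + 1) => P (T^[(j : ℕ)] x)) / (n + 1))

/-- The V-statistics `V_Φ(n, x) = n^{-r} ∑_{1 ≤ i_1, …, i_r ≤ n} Φ(T^{i_1}x, …, T^{i_r}x)`. -/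
noncomputable def Vstat {r : ℕ} (T : X → X) (Φ : (Fin r → X) → ℝ) (n : ℕ) (x : X) : ℝ :=
  (∑ i : Fin r → Fin n, Φ (fun j => T^[(i j : ℕ) + 1] x)) / (n : ℝ) ^ r

/-- The level set `E_Φ(α) = {x : lim_n V_Φ(n,x) = α}`. -/
def Eset {r : ℕ} (T : X → X) (Φ : (Fin r → X) → ℝ) (α : ℝ) : Set X :=
  {x | Tendsto (fun n => Vstat T Φ n x) atTop (𝓝 α)}

/-- The fiber `M_Φ(α)`: the `T`-invariant Borel probability measures `μ` with
`∫_{X^r} Φ dμ^{⊗r} = α`. -/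
def Mset {r : ℕ} (T : X → X) (Φ : (Fin r → X) → ℝ) (α : ℝ) : Set (Measure X) :=
  {μ | IsProbabilityMeasure μ ∧ MeasurePreserving T μ μ ∧
    ∫ y, Φ y ∂(Measure.pi fun _ : Fin r => μ) = α}

end Defs

section Shift

/- The metric `d(x,y) = (1/2)^{min {n : x_n ≠ y_n}}` on the symbolic space
`Σ_m = {0, …, m-1}^ℕ`; its topology is the product topology. -/
attribute [local instance] PiNat.metricSpace

/-- The shift map `σ` on `Σ_m = {0, …, m-1}^ℕ`. -/
def shift (m : ℕ) : (ℕ → Fin m) → (ℕ → Fin m) := fun x n => x (n + 1)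

/-- The cylinder set `[w] = [a_1, …, a_n]` of sequences starting with the word `w`. -/
def cyl {m : ℕ} (w : List (Fin m)) : Set (ℕ → Fin m) :=
  {x | ∀ i : ℕ, ∀ h : i < w.length, x i = w.get ⟨i, h⟩}

/-- A shift-invariant measure `μ` on `Σ_m` is an `s`-step Markov measure if the conditional
distribution of each coordinate given the past depends only on the preceding `s`
coordinates: for every word `u` of length at least `s` and every letter `a`,
`μ[ua] ⬝ μ[last s letters of u] = μ[u] ⬝ μ[(last s letters of u)a]`. -/
def IsMarkovOfStep {m : ℕ} (s : ℕ) (μ : Measure (ℕ → Fin m)) : Prop :=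
  MeasurePreserving (shift m) μ μ ∧
  ∀ (u : List (Fin m)) (a : Fin m), s ≤ u.length →
    μ (cyl (u ++ [a])) * μ (cyl (u.drop (u.length - s))) =
      μ (cyl u) * μ (cyl (u.drop (u.length - s) ++ [a]))

section Ent

open Real

/-- Sum-level strong subadditivity of Shannon entropy. -/
theorem sum_submod_key {α β γ : Type} [Fintype α] [Fintype β] [Fintype γ]
    (p : α → β → γ → ℝ) :
    (∑ a, ∑ b, negMulLog (∑ c, p a b c)) + (∑ b, ∑ c, negMulLog (∑ a, p a b c))
      - (∑ a, ∑ b, ∑ c, negMulLog (p a b c)) - (∑ b, negMulLog (∑ a, ∑ c, p a b c))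
    = ∑ a, ∑ b, ∑ c, p a b c * (log (p a b c) + log (∑ a, ∑ c, p a b c)
        - log (∑ c, p a b c) - log (∑ a, p a b c)) := by
  have h1 : (∑ a, ∑ b, negMulLog (∑ c, p a b c))
      = ∑ a, ∑ b, ∑ c, -(p a b c * log (∑ c, p a b c)) := by
    refine Finset.sum_congr rfl fun a _ => Finset.sum_congr rfl fun b _ => ?_
    rw [negMulLog, neg_mul, Finset.sum_mul, Finset.sum_neg_distrib]
  have h2 : (∑ b, ∑ c, negMulLog (∑ a, p a b c))
      = ∑ a, ∑ b, ∑ c, -(p a b c * log (∑ a, p a b c)) := by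
    rw [Finset.sum_comm (s := (Finset.univ : Finset α))]
    refine Finset.sum_congr rfl fun b _ => ?_
    rw [Finset.sum_comm (s := (Finset.univ : Finset α))]
    refine Finset.sum_congr rfl fun c _ => ?_
    rw [negMulLog, neg_mul, Finset.sum_mul, Finset.sum_neg_distrib]
  have h3 : (∑ b, negMulLog (∑ a, ∑ c, p a b c))
      = ∑ a, ∑ b, ∑ c, -(p a b c * log (∑ a, ∑ c, p a b c)) := by
    rw [Finset.sum_comm (s := (Finset.univ : Finset α))]
    refine Finset.sum_congr rfl fun b _ => ?_
    rw [negMulLog, neg_mul, Finset.sum_mul, ← Finset.sum_neg_distrib]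
    refine Finset.sum_congr rfl fun a _ => ?_
    rw [Finset.sum_mul, Finset.sum_neg_distrib]
  rw [h1, h2, h3]
  simp only [← Finset.sum_add_distrib, ← Finset.sum_sub_distrib]
  refine Finset.sum_congr rfl fun a _ => Finset.sum_congr rfl fun b _ =>
    Finset.sum_congr rfl fun c _ => ?_
  rw [negMulLog]; ring

theorem sum_submod {α β γ : Type} [Fintype α] [Fintype β] [Fintype γ]
    (p : α → β → γ → ℝ) (hp : ∀ a b c, 0 ≤ p a b c) :
    (∑ a, ∑ b, ∑ c, negMulLog (p a b c)) + (∑ b, negMulLog (∑ a, ∑ c, p a b c))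
    ≤ (∑ a, ∑ b, negMulLog (∑ c, p a b c)) + (∑ b, ∑ c, negMulLog (∑ a, p a b c)) := by
  have key := sum_submod_key p
  have hterm : ∀ a b c, p a b c - (∑ c, p a b c) * (∑ a, p a b c) / (∑ a, ∑ c, p a b c) ≤
      p a b c * (log (p a b c) + log (∑ a, ∑ c, p a b c)
        - log (∑ c, p a b c) - log (∑ a, p a b c)) := by
    intro a b c
    have hxy : p a b c ≤ ∑ c, p a b c :=
      Finset.single_le_sum (f := fun c => p a b c) (fun c _ => hp a b c) (Finset.mem_univ c)
    have hyz : p a b c ≤ ∑ a, p a b c :=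
      Finset.single_le_sum (f := fun a => p a b c) (fun a _ => hp a b c) (Finset.mem_univ a)
    have hy : ∑ c, p a b c ≤ ∑ a, ∑ c, p a b c :=
      Finset.single_le_sum (f := fun a => ∑ c, p a b c)
        (fun a _ => Finset.sum_nonneg fun c _ => hp a b c) (Finset.mem_univ a)
    generalize (∑ c, p a b c) = X at *
    generalize (∑ a, p a b c) = Y at *
    generalize (∑ a, ∑ c, p a b c) = Z at *
    generalize hP : p a b c = P at *
    have hP0 : 0 ≤ P := hP ▸ hp a b c
    rcases hP0.eq_or_lt with h | h
    · rw [← h]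
      have : 0 ≤ X * Y / Z := by
        have : 0 ≤ X := by linarith
        have : 0 ≤ Y := by linarith
        have : 0 ≤ Z := by linarith
        positivity
      linarith
    · have hX : 0 < X := by linarith
      have hY : 0 < Y := by linarith
      have hZ : 0 < Z := by linarith
      have := Real.log_le_sub_one_of_pos (x := X * Y / (P * Z)) (by positivity)
      rw [log_div (by positivity) (by positivity), log_mul hX.ne' hY.ne',
        log_mul h.ne' hZ.ne'] at this
      have h2 := mul_le_mul_of_nonneg_left this h.le
      have h3 : P * (X * Y / (P * Z) - 1) = X * Y / Z - P := by field_simp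
      rw [h3] at h2
      nlinarith
  have hsum : ∑ a, ∑ b, ∑ c, (p a b c - (∑ c, p a b c) * (∑ a, p a b c) / (∑ a, ∑ c, p a b c))
      = 0 := by
    simp only [Finset.sum_sub_distrib]
    rw [sub_eq_zero, Finset.sum_comm, Finset.sum_comm (s := (Finset.univ : Finset α))]
    refine Finset.sum_congr rfl fun b _ => ?_
    have : ∑ a, ∑ c, p a b c = ∑ c, ∑ a, p a b c := Finset.sum_comm
    simp only [← Finset.mul_sum, ← Finset.sum_div, ← Finset.sum_mul]
    rw [← this]
    by_cases h0 : ∑ a, ∑ c, p a b c = 0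
    · simp [h0]
    · field_simp
  have : 0 ≤ ∑ a, ∑ b, ∑ c, p a b c * (log (p a b c) + log (∑ a, ∑ c, p a b c)
        - log (∑ c, p a b c) - log (∑ a, p a b c)) := by
    rw [← hsum]
    exact Finset.sum_le_sum fun a _ => Finset.sum_le_sum fun b _ =>
      Finset.sum_le_sum fun c _ => hterm a b c
  linarith

theorem sum_submod_eq {α β γ : Type} [Fintype α] [Fintype β] [Fintype γ]
    (p : α → β → γ → ℝ) (hp : ∀ a b c, 0 ≤ p a b c)
    (hM : ∀ a b c, p a b c * (∑ a, ∑ c, p a b c) = (∑ c, p a b c) * (∑ a, p a b c)) :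
    (∑ a, ∑ b, ∑ c, negMulLog (p a b c)) + (∑ b, negMulLog (∑ a, ∑ c, p a b c))
    = (∑ a, ∑ b, negMulLog (∑ c, p a b c)) + (∑ b, ∑ c, negMulLog (∑ a, p a b c)) := by
  have key := sum_submod_key p
  have : ∑ a, ∑ b, ∑ c, p a b c * (log (p a b c) + log (∑ a, ∑ c, p a b c)
        - log (∑ c, p a b c) - log (∑ a, p a b c)) = 0 := by
    refine Finset.sum_eq_zero fun a _ => Finset.sum_eq_zero fun b _ =>
      Finset.sum_eq_zero fun c _ => ?_
    have hxy : p a b c ≤ ∑ c, p a b c :=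
      Finset.single_le_sum (f := fun c => p a b c) (fun c _ => hp a b c) (Finset.mem_univ c)
    have hyz : p a b c ≤ ∑ a, p a b c :=
      Finset.single_le_sum (f := fun a => p a b c) (fun a _ => hp a b c) (Finset.mem_univ a)
    have hy : ∑ c, p a b c ≤ ∑ a, ∑ c, p a b c :=
      Finset.single_le_sum (f := fun a => ∑ c, p a b c)
        (fun a _ => Finset.sum_nonneg fun c _ => hp a b c) (Finset.mem_univ a)
    have hm := hM a b c
    rcases (hp a b c).eq_or_lt with h | h
    · rw [← h]; simp
    · have := congrArg log hm
      rw [log_mul h.ne' (by linarith), log_mul (by linarith) (by linarith)] at this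
      rw [this]; ring
  linarith

variable {X : Type*} [MeasurableSpace X]

/-- Shannon entropy of a finite-valued function. -/
noncomputable def Hent {ι : Type} [Fintype ι] (μ : Measure X) (P : X → ι) : ℝ :=
  ∑ i : ι, negMulLog (μ.real (P ⁻¹' {i}))

/-- All fibres are measurable. -/
def FM {ι : Type} (P : X → ι) : Prop := ∀ S : Set ι, MeasurableSet (P ⁻¹' S)

theorem FM.of_singleton {ι : Type} [Finite ι] {P : X → ι}
    (h : ∀ i, MeasurableSet (P ⁻¹' {i})) : FM P := by
  intro S
  have : P ⁻¹' S = ⋃ i ∈ S, P ⁻¹' {i} := by ext; simp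
  rw [this]
  exact MeasurableSet.biUnion (Set.to_countable S) fun i _ => h i

theorem FM.comp {ι κ : Type} {P : X → ι} (h : FM P) (f : ι → κ) : FM (fun x => f (P x)) :=
  fun S => h (f ⁻¹' S)

theorem FM.comp_right {ι : Type} {P : X → ι} (h : FM P) {T : X → X} (hT : Measurable T) :
    FM (fun x => P (T x)) :=
  fun S => hT (h S)

theorem FM.prod {ι κ : Type} [Finite ι] [Finite κ] {P : X → ι} {Q : X → κ} (h : FM P)
    (h' : FM Q) : FM (fun x => (P x, Q x)) := by
  refine FM.of_singleton fun ⟨i, j⟩ => ?_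
  have : (fun x => (P x, Q x)) ⁻¹' {(i, j)} = P ⁻¹' {i} ∩ Q ⁻¹' {j} := by ext; simp
  rw [this]
  exact (h _).inter (h' _)

theorem FM.pi {n : ℕ} {ι : Type} [Finite ι] {P : Fin n → X → ι} (h : ∀ j, FM (P j)) :
    FM (fun x j => P j x) := by
  refine FM.of_singleton fun i => ?_
  have : (fun x j => P j x) ⁻¹' {i} = ⋂ j, P j ⁻¹' {i j} := by ext; simp [funext_iff]
  rw [this]
  exact MeasurableSet.iInter fun j => h j _

theorem real_preimage_sum {ι : Type} [Fintype ι] (μ : Measure X) [IsFiniteMeasure μ] {Q : X → ι}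
    (hQ : FM Q) (S : Finset ι) : μ.real (Q ⁻¹' S) = ∑ i ∈ S, μ.real (Q ⁻¹' {i}) := by
  rw [← measureReal_biUnion_finset]
  · congr 1; ext; simp
  · intro i _ j _ hij
    exact Disjoint.preimage _ (by simpa using hij)
  · exact fun i _ => hQ _

variable (μ : Measure X) [IsProbabilityMeasure μ]

theorem Hent_submod_aux {α β γ : Type} [Fintype α] [Fintype β] [Fintype γ]
    {A : X → α} {B : X → β} {C : X → γ} (hA : FM A) (hB : FM B) (hC : FM C) :
    (∀ a b, μ.real ((fun x => (A x, B x)) ⁻¹' {(a, b)}) =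
      ∑ c, μ.real ((fun x => (A x, B x, C x)) ⁻¹' {(a, b, c)})) ∧
    (∀ b c, μ.real ((fun x => (B x, C x)) ⁻¹' {(b, c)}) =
      ∑ a, μ.real ((fun x => (A x, B x, C x)) ⁻¹' {(a, b, c)})) ∧
    (∀ b, μ.real (B ⁻¹' {b}) =
      ∑ a, ∑ c, μ.real ((fun x => (A x, B x, C x)) ⁻¹' {(a, b, c)})) := by
  classical
  have h := hA.prod (hB.prod hC)
  refine ⟨fun a b => ?_, fun b c => ?_, fun b => ?_⟩
  · rw [← Finset.sum_image (f := fun i => μ.real ((fun x => (A x, B x, C x)) ⁻¹' {i}))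
      (g := fun c => (a, b, c)) (by intro _ _ _ _ h; simpa using h), ← real_preimage_sum μ h]
    congr 1; ext x; simp; grind
  · rw [← Finset.sum_image (f := fun i => μ.real ((fun x => (A x, B x, C x)) ⁻¹' {i}))
      (g := fun a => (a, b, c)) (by intro _ _ _ _ h; simpa using h), ← real_preimage_sum μ h]
    congr 1; ext x; simp; grind
  · rw [← Fintype.sum_prod_type' (f := fun a c => μ.real ((fun x => (A x, B x, C x)) ⁻¹' {(a, b, c)}))]
    rw [← Finset.sum_image (f := fun i => μ.real ((fun x => (A x, B x, C x)) ⁻¹' {i}))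
      (g := fun ac : α × γ => (ac.1, b, ac.2))
      (by rintro ⟨_, _⟩ _ ⟨_, _⟩ _ h; simpa using h), ← real_preimage_sum μ h]
    congr 1; ext x; simp; grind

theorem Hent_submod {α β γ : Type} [Fintype α] [Fintype β] [Fintype γ]
    {A : X → α} {B : X → β} {C : X → γ} (hA : FM A) (hB : FM B) (hC : FM C) :
    Hent μ (fun x => (A x, B x, C x)) + Hent μ B ≤
      Hent μ (fun x => (A x, B x)) + Hent μ (fun x => (B x, C x)) := by
  obtain ⟨h1, h2, h3⟩ := Hent_submod_aux μ hA hB hC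
  have := sum_submod (fun a b c => μ.real ((fun x => (A x, B x, C x)) ⁻¹' {(a, b, c)}))
    (fun _ _ _ => measureReal_nonneg)
  simp only [← h3] at this
  simp only [← h1, ← h2] at this
  simpa only [Hent, Fintype.sum_prod_type] using this

theorem Hent_submod_eq {α β γ : Type} [Fintype α] [Fintype β] [Fintype γ]
    {A : X → α} {B : X → β} {C : X → γ} (hA : FM A) (hB : FM B) (hC : FM C)
    (hM : ∀ a b c, μ.real ((fun x => (A x, B x, C x)) ⁻¹' {(a, b, c)}) * μ.real (B ⁻¹' {b}) =
      μ.real ((fun x => (A x, B x)) ⁻¹' {(a, b)}) * μ.real ((fun x => (B x, C x)) ⁻¹' {(b, c)})) :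
    Hent μ (fun x => (A x, B x, C x)) + Hent μ B =
      Hent μ (fun x => (A x, B x)) + Hent μ (fun x => (B x, C x)) := by
  obtain ⟨h1, h2, h3⟩ := Hent_submod_aux μ hA hB hC
  have := sum_submod_eq (fun a b c => μ.real ((fun x => (A x, B x, C x)) ⁻¹' {(a, b, c)}))
    (fun _ _ _ => measureReal_nonneg) (by
      simp only [← h3]
      simp only [← h1, ← h2]
      exact hM)
  simp only [← h3] at this
  simp only [← h1, ← h2] at this
  simpa only [Hent, Fintype.sum_prod_type] using this

theorem Hent_factor {ι κ : Type} [Fintype ι] [Fintype κ] {Q : X → ι} (hQ : FM Q) {P : X → κ}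
    (f : ι → κ) (hP : ∀ x, P x = f (Q x)) : Hent μ P ≤ Hent μ Q := by
  classical
  obtain rfl : P = fun x => f (Q x) := funext hP
  unfold Hent
  rw [← Finset.sum_fiberwise_of_maps_to (t := Finset.univ) (g := f) (fun _ _ => Finset.mem_univ _)
    (fun i => negMulLog (μ.real (Q ⁻¹' {i})))]
  refine Finset.sum_le_sum fun k _ => ?_
  have h1 : μ.real ((fun x => f (Q x)) ⁻¹' {k}) =
      ∑ i ∈ Finset.univ.filter (fun i => f i = k), μ.real (Q ⁻¹' {i}) := by
    rw [← real_preimage_sum μ hQ]; congr 1; ext; simp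
  rw [h1, negMulLog, neg_mul, Finset.sum_mul, ← Finset.sum_neg_distrib]
  refine Finset.sum_le_sum fun i hi => ?_
  rw [negMulLog, neg_mul, neg_le_neg_iff]
  rcases (measureReal_nonneg (μ := μ) (s := Q ⁻¹' {i})).eq_or_lt with h | h
  · rw [← h]; simp
  · refine mul_le_mul_of_nonneg_left (log_le_log h ?_) h.le
    exact Finset.single_le_sum (f := fun i => μ.real (Q ⁻¹' {i}))
      (fun _ _ => measureReal_nonneg) hi

theorem Hent_congr {ι κ : Type} [Fintype ι] [Fintype κ] {Q : X → ι} (hQ : FM Q) {P : X → κ}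
    (f : ι → κ) (g : κ → ι) (hP : ∀ x, P x = f (Q x)) (hg : ∀ x, Q x = g (P x)) :
    Hent μ P = Hent μ Q := by
  refine le_antisymm (Hent_factor μ hQ f hP) (Hent_factor μ ?_ g hg)
  obtain rfl : P = fun x => f (Q x) := funext hP
  exact hQ.comp f

theorem Hent_const {ι : Type} [Fintype ι] [Unique ι] (P : X → ι) : Hent μ P = 0 := by
  unfold Hent
  rw [Fintype.sum_unique]
  have : P ⁻¹' {default} = Set.univ := by
    ext x; simpa using Subsingleton.elim _ _
  rw [this]; simp

theorem Hent_comp {ι : Type} [Fintype ι] {P : X → ι} (hP : FM P) {T : X → X}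
    (hT : MeasurePreserving T μ μ) : Hent μ (fun x => P (T x)) = Hent μ P := by
  unfold Hent
  refine Finset.sum_congr rfl fun i _ => ?_
  congr 1
  exact hT.measureReal_preimage (hP {i}).nullMeasurableSet

/-- Conditional entropy. -/
noncomputable def Cent {ι κ : Type} [Fintype ι] [Fintype κ] (μ : Measure X) (Z : X → ι)
    (Y : X → κ) : ℝ := Hent μ (fun x => (Z x, Y x)) - Hent μ Y

theorem Cent_anti {ι κ κ' : Type} [Fintype ι] [Fintype κ] [Fintype κ'] {Z : X → ι} {Y : X → κ}
    {Y' : X → κ'} (hZ : FM Z) (hY' : FM Y') (f : κ' → κ) (hf : ∀ x, Y x = f (Y' x)) :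
    Cent μ Z Y' ≤ Cent μ Z Y := by
  have hY : FM Y := by
    obtain rfl : Y = fun x => f (Y' x) := funext hf
    exact hY'.comp f
  have h1 := Hent_submod μ hZ hY hY'
  have h2 := Hent_factor μ hY' (P := fun x => (Y x, Y' x)) (fun y => (f y, y))
    (fun x => by rw [hf])
  have h3 := Hent_factor μ (hZ.prod (hY.prod hY')) (P := fun x => (Z x, Y' x))
    (fun y => (y.1, y.2.2)) (fun x => rfl)
  unfold Cent
  linarith

theorem Cent_tuple {ι κ : Type} [Fintype ι] [Fintype κ] {Y : X → κ} (hY : FM Y) (n : ℕ)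
    (Z : Fin n → X → ι) (hZ : ∀ j, FM (Z j)) :
    Cent μ (fun x j => Z j x) Y ≤ ∑ j, Cent μ (Z j) Y := by
  classical
  induction n with
  | zero =>
    have := Hent_factor μ hY (P := fun x => ((fun j => Z j x : Fin 0 → ι), Y x))
      (fun y => (Fin.elim0, y)) (fun x => by congr 1; exact Subsingleton.elim _ _)
    simp only [Finset.univ_eq_empty, Finset.sum_empty]
    unfold Cent; linarith
  | succ n ih =>
    have ih' := ih (fun j => Z j.castSucc) (fun j => hZ _)
    rw [Fin.sum_univ_castSucc]
    have hZn : FM (fun x (j : Fin n) => Z j.castSucc x) := FM.pi fun j => hZ _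
    have h1 := Cent_anti μ (hZ (Fin.last n)) (hZn.prod hY) (Y := Y) (fun y => y.2) (fun x => rfl)
    have h2 := Hent_factor μ ((hZ (Fin.last n)).prod (hZn.prod hY))
      (P := fun x => ((fun j => Z j x : Fin (n+1) → ι), Y x))
      (fun y => (Fin.snoc (α := fun _ => ι) y.2.1 y.1, y.2.2)) (fun x => by
        congr 1; ext j
        refine Fin.lastCases ?_ (fun i => ?_) j <;> simp)
    unfold Cent at *
    linarith

end Ent

section KSpart

variable {m : ℕ}

theorem Hent_nonneg {X : Type*} [MeasurableSpace X] (μ : Measure X) [IsProbabilityMeasure μ]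
    {ι : Type} [Fintype ι] {P : X → ι} (hP : FM P) : 0 ≤ Hent μ P := by
  have := Hent_factor μ hP (P := fun _ => ()) (fun _ => ()) (fun _ => rfl)
  rwa [Hent_const] at this

/-- The first `n` letters. -/
def Blk (m n : ℕ) : (ℕ → Fin m) → (Fin n → Fin m) := fun x i => x i

theorem FM_eval (i : ℕ) : FM (fun x : ℕ → Fin m => x i) :=
  fun _ => measurable_pi_apply i (MeasurableSet.of_discrete)

theorem FM_Blk (n : ℕ) : FM (Blk m n) := FM.pi fun j => FM_eval (j : ℕ)

theorem measurable_shift : Measurable (shift m) :=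
  measurable_pi_lambda _ fun n => measurable_pi_apply (n + 1)

theorem shift_iter (j : ℕ) (x : ℕ → Fin m) (i : ℕ) : (shift m)^[j] x i = x (i + j) := by
  induction j generalizing x with
  | zero => rfl
  | succ j ih => rw [Function.iterate_succ_apply, ih]; simp only [shift]; congr 1

theorem cylinders_blk {A : Set (ℕ → Fin m)} (hA : A ∈ measurableCylinders (fun _ : ℕ => Fin m)) :
    ∃ (N : ℕ) (S : Set (Fin N → Fin m)), A = Blk m N ⁻¹' S := by
  obtain ⟨s, S, -, rfl⟩ := (mem_measurableCylinders _).1 hA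
  refine ⟨s.sup id + 1,
    {w | (fun i : s => w ⟨i, Nat.lt_succ_of_le (Finset.le_sup (f := id) i.2)⟩) ∈ S}, ?_⟩
  ext x
  simp only [mem_cylinder, Set.mem_preimage, Set.mem_ofPred_eq]
  rfl

variable (μ : Measure (ℕ → Fin m)) [IsProbabilityMeasure μ]

open Classical in
theorem Cent_set_small {B : Set (ℕ → Fin m)} (hB : MeasurableSet B) {ε : ℝ} (hε : 0 < ε) :
    ∃ N₀, ∀ N ≥ N₀, Cent μ (fun x => decide (x ∈ B)) (Blk m N) ≤ ε := by
  have hcont : Tendsto (fun t : ℝ => Real.negMulLog t + Real.negMulLog (1 - t)) (𝓝 0) (𝓝 0) := by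
    have : Continuous (fun t : ℝ => Real.negMulLog t + Real.negMulLog (1 - t)) := by fun_prop
    simpa using this.tendsto 0
  obtain ⟨δ, hδ, hδ'⟩ := Metric.eventually_nhds_iff.1 (hcont.eventually_lt_const hε)
  obtain ⟨A, hA, hAB⟩ := exists_measure_symmDiff_lt_of_generateFrom_isSetRing (μ := μ)
    (isSetRing_measurableCylinders (α := fun _ : ℕ => Fin m))
    ⟨{Set.univ}, by simp, by
      simpa using univ_mem_measurableCylinders (fun _ : ℕ => Fin m), by simp⟩
    (generateFrom_measurableCylinders (α := fun _ : ℕ => Fin m)).symm hB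
    (ENNReal.ofReal_pos.2 hδ)
  have hAm : MeasurableSet A := MeasurableSet.of_mem_measurableCylinders hA
  obtain ⟨N₀, S, rfl⟩ := cylinders_blk hA
  refine ⟨N₀, fun N hN => ?_⟩
  have fm : ∀ {E : Set (ℕ → Fin m)}, MeasurableSet E → FM (fun x => decide (x ∈ E)) := by
    intro E hE
    refine FM.of_singleton fun b => ?_
    cases b
    · convert hE.compl using 1; ext; simp
    · convert hE using 1; ext; simp
  set A := Blk m N₀ ⁻¹' S with hAdef
  have hD : MeasurableSet (symmDiff A B) := hAm.symmDiff hB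
  have h1 := Cent_anti μ (fm hB) (FM_Blk N) (Y := fun x => decide (x ∈ A))
    (fun w => decide ((fun i : Fin N₀ => w (Fin.castLE hN i)) ∈ S)) (fun x => rfl)
  have h2 := Hent_factor μ ((fm hD).prod (fm hAm))
    (P := fun x => (decide (x ∈ B), decide (x ∈ A)))
    (fun y => (xor y.1 y.2, y.2)) (fun x => by
      by_cases h : x ∈ A <;> by_cases h' : x ∈ B <;> simp [Set.mem_symmDiff, h, h'])
  have h3 := Hent_submod μ (fm hD) (B := fun _ => ()) (fun _ => MeasurableSet.const _) (fm hAm)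
  have h3' : Hent μ (fun _ : ℕ → Fin m => ()) = 0 := Hent_const μ _
  have h4 := Hent_factor μ ((fm hD).prod
    (FM.prod (P := fun _ => ()) (fun _ => MeasurableSet.const _) (fm hAm)))
    (P := fun x => (decide (x ∈ symmDiff A B), decide (x ∈ A)))
    (fun y => (y.1, y.2.2)) (fun x => rfl)
  have h5 := Hent_factor μ (fm hD) (P := fun x => (decide (x ∈ symmDiff A B), ()))
    (fun y => (y, ())) (fun x => rfl)
  have h6 := Hent_factor μ (fm hAm) (P := fun x => ((), decide (x ∈ A)))
    (fun y => ((), y)) (fun x => rfl)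
  have h7 : Hent μ (fun x => decide (x ∈ symmDiff A B)) < ε := by
    have e1 : (fun x => decide (x ∈ symmDiff A B)) ⁻¹' {true} = symmDiff A B := by ext; simp
    have e2 : (fun x => decide (x ∈ symmDiff A B)) ⁻¹' {false} = (symmDiff A B)ᶜ := by
      ext x
      rw [Set.mem_preimage, Set.mem_singleton_iff, decide_eq_false_iff_not, Set.mem_compl_iff]
    rw [Hent, Fintype.sum_bool, e1, e2, probReal_compl_eq_one_sub hD]
    apply hδ'
    rw [Real.dist_eq, sub_zero, abs_of_nonneg measureReal_nonneg]
    exact (ENNReal.lt_ofReal_iff_toReal_lt (measure_ne_top _ _)).1 hAB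
  unfold Cent at *
  linarith

open Classical in
theorem Cent_small {r : ℕ} {P : (ℕ → Fin m) → Fin r} (hP : FM P) {ε : ℝ} (hε : 0 < ε) :
    ∃ N, Cent μ P (Blk m N) ≤ ε := by
  have hne : Nonempty (ℕ → Fin m) := by
    by_contra h
    rw [not_nonempty_iff] at h
    have := measure_univ (μ := μ)
    simp [Set.univ_eq_empty_iff.2 h] at this
  obtain ⟨x₀⟩ := hne
  have hr : 0 < (r : ℝ) := by exact_mod_cast (Fin.pos (P x₀))
  choose N hN using fun i : Fin r => Cent_set_small μ (hP {i}) (div_pos hε hr)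
  refine ⟨Finset.univ.sup N, ?_⟩
  have fm : ∀ i : Fin r, FM (fun x => decide (x ∈ P ⁻¹' {i})) := fun i =>
    hP.comp (fun y => @decide (y ∈ ({i} : Set (Fin r))) (propDecidable _))
  have h1 := Cent_tuple μ (FM_Blk (m := m) (Finset.univ.sup N)) r
    (fun i x => decide (x ∈ P ⁻¹' {i})) fm
  have h2 : ∑ j, Cent μ (fun x => decide (x ∈ P ⁻¹' {j})) (Blk m (Finset.univ.sup N)) ≤ ε := by
    calc _ ≤ ∑ j : Fin r, ε / r :=
          Finset.sum_le_sum fun j _ => hN j _ (Finset.le_sup (Finset.mem_univ j))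
      _ = ε := by simp; field_simp
  have h3 := Hent_factor μ ((FM.pi fm).prod (FM_Blk (m := m) (Finset.univ.sup N)))
    (P := fun x => (P x, Blk m (Finset.univ.sup N) x))
    (fun y => (if h : ∃ i, y.1 i = true then h.choose else P x₀, y.2)) (fun x => by
      have h : ∃ i, decide (x ∈ P ⁻¹' {i}) = true := ⟨P x, by simp⟩
      have h' := h.choose_spec
      simp only [Set.mem_preimage, Set.mem_singleton_iff, decide_eq_true_eq] at h'
      congr 1
      rw [dif_pos h]
      simpa using h')
  unfold Cent at *
  linarith

theorem KS_bound (hT : MeasurePreserving (shift m) μ μ) {r : ℕ} {P : (ℕ → Fin m) → Fin r}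
    (hP : FM P) (n N : ℕ) :
    Hent μ (fun x (j : Fin n) => P ((shift m)^[(j : ℕ)] x)) ≤
      Hent μ (Blk m (n + N)) + n * Cent μ P (Blk m N) := by
  have fm : ∀ j : Fin n, FM (fun x => P ((shift m)^[(j : ℕ)] x)) := fun j =>
    hP.comp_right (hT.iterate j).measurable
  have h1 := Cent_tuple μ (FM_Blk (m := m) (n + N)) n
    (fun j x => P ((shift m)^[(j : ℕ)] x)) fm
  have h2 : ∀ j : Fin n, Cent μ (fun x => P ((shift m)^[(j : ℕ)] x)) (Blk m (n + N)) ≤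
      Cent μ P (Blk m N) := by
    intro j
    have h3 := Cent_anti μ (fm j) (FM_Blk (m := m) (n + N))
      (Y := fun x => Blk m N ((shift m)^[(j : ℕ)] x))
      (fun w i => w ⟨i + j, by omega⟩) (fun x => by
        funext i; simp only [Blk]; rw [shift_iter])
    refine h3.trans (le_of_eq ?_)
    unfold Cent
    rw [Hent_comp μ (FM_Blk N) (hT.iterate j)]
    rw [Hent_comp μ (P := fun x => (P x, Blk m N x)) (hP.prod (FM_Blk N)) (hT.iterate j)]
  have h4 : ∑ j : Fin n, Cent μ (fun x => P ((shift m)^[(j : ℕ)] x)) (Blk m (n + N)) ≤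
      n * Cent μ P (Blk m N) := by
    refine (Finset.sum_le_sum fun j _ => h2 j).trans ?_
    simp
  have h5 := Hent_factor μ ((FM.pi fm).prod (FM_Blk (m := m) (n + N)))
    (P := fun x (j : Fin n) => P ((shift m)^[(j : ℕ)] x)) (fun y => y.1) (fun x => rfl)
  unfold Cent at *
  linarith

/-- The three relevant identifications of blocks. -/
theorem blk_idents (hT : MeasurePreserving (shift m) μ μ) (n : ℕ) :
    Hent μ (fun x => (x 0, Blk m n (shift m x), x (n + 1))) = Hent μ (Blk m (n + 2)) ∧
    Hent μ (fun x => Blk m n (shift m x)) = Hent μ (Blk m n) ∧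
    Hent μ (fun x => (x 0, Blk m n (shift m x))) = Hent μ (Blk m (n + 1)) ∧
    Hent μ (fun x => (Blk m n (shift m x), x (n + 1))) = Hent μ (Blk m (n + 1)) := by
  refine ⟨?_, ?_, ?_, ?_⟩
  · refine Hent_congr μ (FM_Blk _) (fun w => (w 0, fun i => w i.castSucc.succ, w (Fin.last _)))
      (fun y => Fin.cons (α := fun _ => Fin m) y.1 (Fin.snoc (α := fun _ => Fin m) y.2.1 y.2.2))
      (fun x => rfl) (fun x => ?_)
    funext i
    refine Fin.cases rfl (fun j => ?_) i
    refine Fin.lastCases ?_ (fun j => ?_) j <;> simp [Blk, shift]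
  · exact Hent_comp μ (FM_Blk n) hT
  · refine Hent_congr μ (FM_Blk _) (fun w => (w 0, fun i => w i.succ))
      (fun y => Fin.cons (α := fun _ => Fin m) y.1 y.2)
      (fun x => rfl) (fun x => ?_)
    funext i
    refine Fin.cases rfl (fun j => ?_) i
    simp [Blk, shift]
  · rw [← Hent_comp μ (FM_Blk (n + 1)) hT]
    refine Hent_congr μ ((FM_Blk _).comp_right measurable_shift)
      (fun w => (fun i => w i.castSucc, w (Fin.last _)))
      (fun y => Fin.snoc (α := fun _ => Fin m) y.1 y.2)
      (fun x => rfl) (fun x => ?_)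
    funext i
    refine Fin.lastCases ?_ (fun j => ?_) i <;> simp [Blk, shift]

theorem blk_concave (hT : MeasurePreserving (shift m) μ μ) (n : ℕ) :
    Hent μ (Blk m (n + 2)) + Hent μ (Blk m n) ≤
      Hent μ (Blk m (n + 1)) + Hent μ (Blk m (n + 1)) := by
  obtain ⟨h1, h2, h3, h4⟩ := blk_idents μ hT n
  have := Hent_submod μ (FM_eval 0) ((FM_Blk n).comp_right (measurable_shift (m := m)))
    (FM_eval (n + 1))
  rwa [h1, h2, h3, h4] at this

theorem blk_incr_anti (hT : MeasurePreserving (shift m) μ μ) :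
    Antitone (fun n => Hent μ (Blk m (n + 1)) - Hent μ (Blk m n)) := by
  refine antitone_nat_of_succ_le fun n => ?_
  have := blk_concave μ hT n
  change Hent μ (Blk m (n + 2)) - Hent μ (Blk m (n + 1)) ≤ _
  linarith

theorem blk_mono (n : ℕ) : Hent μ (Blk m n) ≤ Hent μ (Blk m (n + 1)) :=
  Hent_factor μ (FM_Blk _) (fun w i => w i.castSucc) (fun _ => rfl)

theorem blk_upper (hT : MeasurePreserving (shift m) μ μ) (s L : ℕ) :
    Hent μ (Blk m L) ≤ Hent μ (Blk m s) +
      L * (Hent μ (Blk m (s + 1)) - Hent μ (Blk m s)) := by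
  have hc := blk_mono μ s
  induction L with
  | zero =>
    have h0 : Hent μ (Blk m 0) = 0 := Hent_const μ _
    have := Hent_nonneg μ (FM_Blk (m := m) s)
    simp [h0, this]
  | succ L ih =>
    rcases le_total (L + 1) s with h | h
    · have := monotone_nat_of_le_succ (blk_mono μ) h
      have h0 : 0 ≤ ((L + 1 : ℕ) : ℝ) * (Hent μ (Blk m (s + 1)) - Hent μ (Blk m s)) :=
        mul_nonneg (by positivity) (by linarith)
      linarith
    · rcases h.eq_or_lt with h | h
      · subst h
        have h0 : 0 ≤ ((L + 1 : ℕ) : ℝ) * (Hent μ (Blk m (L + 1 + 1)) - Hent μ (Blk m (L + 1))) :=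
          mul_nonneg (by positivity) (by linarith)
        linarith
      · have := blk_incr_anti μ hT (Nat.le_of_lt_succ h)
        simp only at this
        push_cast
        linarith

theorem hKS_le (hT : MeasurePreserving (shift m) μ μ) (s : ℕ) :
    hKS (shift m) μ ≤ ENNReal.ofReal (Hent μ (Blk m (s + 1)) - Hent μ (Blk m s)) := by
  refine iSup_le fun r => iSup_le fun P => iSup_le fun hPm => ENNReal.ofReal_le_ofReal ?_
  have hP : FM P := fun S => hPm MeasurableSet.of_discrete
  set c := Hent μ (Blk m (s + 1)) - Hent μ (Blk m s) with hc
  refine le_of_forall_pos_le_add fun ε hε => ?_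
  obtain ⟨N, hN⟩ := Cent_small μ hP hε
  have hbd : BddBelow (Set.range fun n : ℕ =>
      partEntropy μ (fun x => fun j : Fin (n + 1) => P ((shift m)^[(j : ℕ)] x)) / (n + 1)) := by
    refine ⟨0, ?_⟩
    rintro _ ⟨n, rfl⟩
    have : 0 ≤ Hent μ (fun x => fun j : Fin (n + 1) => P ((shift m)^[(j : ℕ)] x)) :=
      Hent_nonneg μ (FM.pi fun j => hP.comp_right (hT.iterate j).measurable)
    exact div_nonneg this (by positivity)
  have hlim : Tendsto (fun n : ℕ => c + ε + (Hent μ (Blk m s) + N * c) * (1 / ((n : ℝ) + 1)))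
      atTop (𝓝 (c + ε)) := by
    have := (tendsto_one_div_add_atTop_nhds_zero_nat (𝕜 := ℝ)).const_mul
      (Hent μ (Blk m s) + N * c)
    simpa using this.const_add (c + ε)
  refine ge_of_tendsto' hlim fun n => (ciInf_le hbd n).trans ?_
  have h1 := KS_bound μ hT hP (n + 1) N
  have h2 := blk_upper μ hT s (n + 1 + N)
  have hpos : (0 : ℝ) < n + 1 := by positivity
  have h3 : ((n + 1 : ℕ) : ℝ) * Cent μ P (Blk m N) ≤ (n + 1) * ε := by
    push_cast
    exact mul_le_mul_of_nonneg_left hN hpos.le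
  have h4 : partEntropy μ (fun x => fun j : Fin (n + 1) => P ((shift m)^[(j : ℕ)] x)) =
    Hent μ (fun x => fun j : Fin (n + 1) => P ((shift m)^[(j : ℕ)] x)) := rfl
  rw [h4, div_le_iff₀ hpos]
  rw [← hc] at h2
  push_cast at h2 h3 h1
  have h5 : (c + ε + (Hent μ (Blk m s) + N * c) * (1 / ((n : ℝ) + 1))) * (n + 1) =
      (n + 1) * (c + ε) + (Hent μ (Blk m s) + N * c) := by
    field_simp
  rw [h5]
  linarith

theorem le_hKS (hT : MeasurePreserving (shift m) μ μ) (c : ℝ)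
    (hc : ∀ n, c ≤ Hent μ (Blk m (n + 1)) - Hent μ (Blk m n)) :
    ENNReal.ofReal c ≤ hKS (shift m) μ := by
  refine le_iSup_of_le m (le_iSup_of_le (fun x => x 0)
    (le_iSup_of_le (measurable_pi_apply 0) (ENNReal.ofReal_le_ofReal ?_)))
  refine le_ciInf fun n => ?_
  have h1 : partEntropy μ (fun x => fun j : Fin (n + 1) => ((shift m)^[(j : ℕ)] x) 0) =
      Hent μ (Blk m (n + 1)) := by
    have : (fun x => fun j : Fin (n + 1) => ((shift m)^[(j : ℕ)] x) 0) = Blk m (n + 1) := by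
      funext x j
      rw [shift_iter]; simp [Blk]
    rw [this]; rfl
  rw [h1, le_div_iff₀ (by positivity)]
  have h2 : ∀ L : ℕ, c * L ≤ Hent μ (Blk m L) := by
    intro L
    induction L with
    | zero =>
      have h0 : Hent μ (Blk m 0) = 0 := Hent_const μ _
      simp [h0]
    | succ L ih => have := hc L; push_cast; linarith
  exact_mod_cast h2 (n + 1)

end KSpart

section Markov

variable {m : ℕ}

theorem mem_cyl_nil (x : ℕ → Fin m) : x ∈ cyl ([] : List (Fin m)) := by
  intro i h; simp at h

theorem mem_cyl_cons (x : ℕ → Fin m) (a : Fin m) (w : List (Fin m)) :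
    x ∈ cyl (a :: w) ↔ x 0 = a ∧ shift m x ∈ cyl w := by
  constructor
  · intro h
    refine ⟨by simpa using h 0 (by simp), fun i hi => ?_⟩
    simpa [shift] using h (i + 1) (by simpa using hi)
  · rintro ⟨h0, h1⟩ i hi
    cases i with
    | zero => simpa using h0
    | succ i => simpa [shift] using h1 i (by simpa using hi)

theorem mem_cyl_append (x : ℕ → Fin m) (u v : List (Fin m)) :
    x ∈ cyl (u ++ v) ↔ x ∈ cyl u ∧ (shift m)^[u.length] x ∈ cyl v := by
  induction u generalizing x with
  | nil => simp [mem_cyl_nil]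
  | cons a u ih => simp only [List.cons_append, mem_cyl_cons, ih, and_assoc, List.length_cons,
      Function.iterate_succ_apply]

theorem mem_cyl_snoc (x : ℕ → Fin m) (u : List (Fin m)) (a : Fin m) :
    x ∈ cyl (u ++ [a]) ↔ x ∈ cyl u ∧ x u.length = a := by
  rw [mem_cyl_append, mem_cyl_cons, shift_iter]; simp [mem_cyl_nil]

theorem mem_cyl_ofFn (x : ℕ → Fin m) {n : ℕ} (w : Fin n → Fin m) :
    x ∈ cyl (List.ofFn w) ↔ Blk m n x = w := by
  constructor
  · intro h; funext i
    simpa [Blk] using h i (by simp)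
  · rintro rfl i hi
    simp [Blk]

theorem cyl_ofFn {n : ℕ} (w : Fin n → Fin m) : cyl (List.ofFn w) = Blk m n ⁻¹' {w} := by
  ext x; rw [mem_cyl_ofFn]; simp

theorem cyl_eq_blk (w : List (Fin m)) : cyl w = Blk m w.length ⁻¹' {w.get} := by
  rw [← cyl_ofFn, List.ofFn_get]

theorem measurableSet_cyl (w : List (Fin m)) : MeasurableSet (cyl w) := by
  rw [cyl_eq_blk]; exact FM_Blk _ _

theorem isClopen_cyl (w : List (Fin m)) : IsClopen (cyl w) := by
  rw [cyl_eq_blk]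
  have : Continuous (Blk m w.length) := continuous_pi fun i => continuous_apply (i : ℕ)
  exact (isClopen_discrete _).preimage this

/-- The measure of mass `p u` obtained by extending `u` by `j` letters. -/
noncomputable def Gm (p : List (Fin m) → ℝ) (z : Fin m) : ℕ → List (Fin m) → Measure (ℕ → Fin m)
  | 0, u => ENNReal.ofReal (p u) • Measure.dirac (fun i => (u[i]?).getD z)
  | j + 1, u => ∑ a, Gm p z j (u ++ [a])

variable (p : List (Fin m) → ℝ) (z : Fin m)

theorem Gm_univ (hp : ∀ w, 0 ≤ p w)
    (hs : ∀ w, ∑ a, p (w ++ [a]) = p w) (j : ℕ) (u : List (Fin m)) : Gm p z j u Set.univ = ENNReal.ofReal (p u) := by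
  induction j generalizing u with
  | zero => simp [Gm]
  | succ j ih =>
    simp only [Gm, Measure.finsetSum_apply, ih]
    rw [← ENNReal.ofReal_sum_of_nonneg (fun _ _ => hp _), hs]

theorem Gm_compl (j : ℕ) (u : List (Fin m)) : Gm p z j u (cyl u)ᶜ = 0 := by
  induction j generalizing u with
  | zero =>
    simp only [Gm, Measure.smul_apply]
    rw [Measure.dirac_apply' _ (measurableSet_cyl u).compl]
    have : (fun i => (u[i]?).getD z) ∈ cyl u := by
      intro i hi; simp [hi]
    simp [this]
  | succ j ih =>
    simp only [Gm, Measure.finsetSum_apply]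
    refine Finset.sum_eq_zero fun a _ => measure_mono_null ?_ (ih (u ++ [a]))
    intro x hx h
    exact hx ((mem_cyl_snoc x u a).1 h).1

theorem Gm_cyl (hp : ∀ w, 0 ≤ p w)
    (hs : ∀ w, ∑ a, p (w ++ [a]) = p w) (j : ℕ) (u v : List (Fin m)) :
    Gm p z (j + u.length) v (cyl (v ++ u)) = ENNReal.ofReal (p (v ++ u)) := by
  induction u generalizing v with
  | nil =>
    rw [List.append_nil, ← Gm_univ p z hp hs (j + 0) v]
    have h := measure_add_measure_compl (μ := Gm p z (j + 0) v) (measurableSet_cyl v)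
    rw [Gm_compl, add_zero] at h
    exact h
  | cons a u ih =>
    have e : v ++ a :: u = (v ++ [a]) ++ u := by simp
    rw [e, List.length_cons, ← add_assoc]
    simp only [Gm, Measure.finsetSum_apply]
    rw [Finset.sum_eq_single a, ih]
    · intro b _ hb
      refine measure_mono_null ?_ (Gm_compl p z _ (v ++ [b]))
      intro x hx h
      rw [mem_cyl_append] at hx
      exact hb (((mem_cyl_snoc x v b).1 h).2.symm.trans ((mem_cyl_snoc x v a).1 hx.1).2)
    · simp

theorem exists_measure_cyl (p : List (Fin m) → ℝ) (z : Fin m) (hp : ∀ w, 0 ≤ p w)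
    (hs : ∀ w, ∑ a, p (w ++ [a]) = p w) (h1 : p [] = 1) :
    ∃ ν : Measure (ℕ → Fin m), IsProbabilityMeasure ν ∧ ∀ w, ν.real (cyl w) = p w := by
  have hprob : ∀ n, IsProbabilityMeasure (Gm p z n []) := fun n =>
    ⟨by rw [Gm_univ p z hp hs, h1]; simp⟩
  let ν : ℕ → ProbabilityMeasure (ℕ → Fin m) := fun n => ⟨Gm p z n [], hprob n⟩
  obtain ⟨ρ, -, hρ⟩ := (isCompact_univ (X := ProbabilityMeasure (ℕ → Fin m))).ultrafilter_le_nhds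
    ((hyperfilter ℕ).map ν) (by simp)
  have ht : Tendsto ν (hyperfilter ℕ) (𝓝 ρ) := hρ
  refine ⟨ρ, inferInstance, fun w => ?_⟩
  have h := ProbabilityMeasure.tendsto_measure_of_isClopen_of_tendsto ht (isClopen_cyl w)
  have h' := (NNReal.tendsto_coe.2 h)
  refine tendsto_nhds_unique h' (tendsto_const_nhds.congr' ?_)
  have : ∀ᶠ n in (hyperfilter ℕ : Filter ℕ), w.length ≤ n :=
    (Nat.hyperfilter_le_atTop) (eventually_ge_atTop _)
  filter_upwards [this] with n hn
  obtain ⟨j, rfl⟩ := Nat.exists_eq_add_of_le' hn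
  have := Gm_cyl p z hp hs j w []
  rw [List.nil_append] at this
  change p w = (Gm p z (j + w.length) [] (cyl w)).toReal
  rw [this, ENNReal.toReal_ofReal (hp w)]

end Markov

section Weights

variable {m : ℕ} (μ : Measure (ℕ → Fin m)) [IsProbabilityMeasure μ]

theorem cyl_nil_real : μ.real (cyl ([] : List (Fin m))) = 1 := by
  have : cyl ([] : List (Fin m)) = Set.univ := by ext x; simp [mem_cyl_nil]
  rw [this]; simp

theorem sum_snoc_real (w : List (Fin m)) : ∑ a, μ.real (cyl (w ++ [a])) = μ.real (cyl w) := by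
  rw [← measureReal_biUnion_finset]
  · congr 1; ext x; simp [mem_cyl_snoc]
  · intro a _ b _ hab
    refine Set.disjoint_left.2 fun x hx hx' => hab ?_
    exact ((mem_cyl_snoc _ _ _).1 hx).2.symm.trans ((mem_cyl_snoc _ _ _).1 hx').2
  · exact fun a _ => measurableSet_cyl _

theorem sum_cons_real_shift (w : List (Fin m)) :
    ∑ a, μ.real (cyl (a :: w)) = μ.real (shift m ⁻¹' cyl w) := by
  rw [← measureReal_biUnion_finset]
  · congr 1; ext x; simp [mem_cyl_cons]
  · intro a _ b _ hab
    refine Set.disjoint_left.2 fun x hx hx' => hab ?_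
    exact ((mem_cyl_cons _ _ _).1 hx).1.symm.trans ((mem_cyl_cons _ _ _).1 hx').1
  · exact fun a _ => measurableSet_cyl _

theorem sum_cons_real (hT : MeasurePreserving (shift m) μ μ) (w : List (Fin m)) : ∑ a, μ.real (cyl (a :: w)) = μ.real (cyl w) := by
  rw [sum_cons_real_shift]
  exact hT.measureReal_preimage (measurableSet_cyl w).nullMeasurableSet

theorem cons_real_le (hT : MeasurePreserving (shift m) μ μ) (a : Fin m) (w : List (Fin m)) : μ.real (cyl (a :: w)) ≤ μ.real (cyl w) := by
  rw [← sum_cons_real μ hT w]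
  exact Finset.single_le_sum (f := fun a => μ.real (cyl (a :: w)))
    (fun _ _ => measureReal_nonneg) (Finset.mem_univ a)

theorem append_real_le (u v : List (Fin m)) : μ.real (cyl (u ++ v)) ≤ μ.real (cyl u) :=
  measureReal_mono fun x hx => ((mem_cyl_append x u v).1 hx).1

/-- Weights of the Markov measure of step `s`. -/
noncomputable def pw (s : ℕ) : List (Fin m) → ℝ
  | [] => 1
  | a :: u => pw s u * (μ.real (cyl (a :: u.take s)) / μ.real (cyl (u.take s)))

theorem pw_nonneg (s : ℕ) (w : List (Fin m)) : 0 ≤ pw μ s w := by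
  induction w with
  | nil => simp [pw]
  | cons a u ih => rw [pw]; positivity

theorem pw_eq (hT : MeasurePreserving (shift m) μ μ) (s : ℕ) (w : List (Fin m)) (hw : w.length ≤ s + 1) :
    pw μ s w = μ.real (cyl w) := by
  induction w with
  | nil => rw [cyl_nil_real, pw]
  | cons a u ih =>
    rw [List.length_cons] at hw
    rw [pw, ih (by omega), List.take_of_length_le (by omega)]
    by_cases h : μ.real (cyl u) = 0
    · have := cons_real_le μ hT a u
      have h2 : 0 ≤ μ.real (cyl (a :: u)) := measureReal_nonneg
      rw [h]; linarith
    · field_simp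

theorem pw_zero (s : ℕ) (w : List (Fin m)) (h : μ.real (cyl (w.take s)) = 0) : pw μ s w = 0 := by
  cases w with
  | nil => rw [List.take_nil, cyl_nil_real] at h; simp at h
  | cons b u =>
    have e : b :: u.take s = (b :: u).take s ++ ((b :: u).drop s).take 1 := by
      rw [← List.take_add, List.take_succ_cons]
    have h1 := append_real_le μ ((b :: u).take s) (((b :: u).drop s).take 1)
    rw [← e, h] at h1
    have h2 : μ.real (cyl (b :: u.take s)) = 0 := le_antisymm h1 measureReal_nonneg
    rw [pw, h2]; simp

theorem pw_sum_cons (hT : MeasurePreserving (shift m) μ μ) (s : ℕ) (w : List (Fin m)) : ∑ a, pw μ s (a :: w) = pw μ s w := by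
  simp only [pw]
  rw [← Finset.mul_sum, ← Finset.sum_div, sum_cons_real μ hT]
  by_cases h : μ.real (cyl (w.take s)) = 0
  · rw [pw_zero μ s w h]; simp
  · field_simp

theorem pw_sum_snoc (hT : MeasurePreserving (shift m) μ μ) (s : ℕ) (w : List (Fin m)) : ∑ a, pw μ s (w ++ [a]) = pw μ s w := by
  induction w with
  | nil =>
    simp only [List.nil_append]
    exact pw_sum_cons μ hT s []
  | cons b u ih =>
    rcases le_or_gt s u.length with h | h
    · simp only [List.cons_append, pw]
      simp only [List.take_append_of_le_length h]
      rw [← Finset.sum_mul, ih]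
    · rw [pw_eq μ hT s _ (by simp; omega), ← sum_snoc_real]
      refine Finset.sum_congr rfl fun a _ => pw_eq μ hT s _ (by simp; omega)

theorem pw_markov_short (s : ℕ) (b : Fin m) (u v : List (Fin m)) (h : s ≤ u.length) :
    pw μ s (b :: (u ++ v)) * pw μ s u = pw μ s (b :: u) * pw μ s (u ++ v) := by
  simp only [pw]
  rw [List.take_append_of_le_length h]; ring

theorem pw_markov (s : ℕ) (u : List (Fin m)) (a : Fin m) (h : s ≤ u.length) :
    pw μ s (u ++ [a]) * pw μ s (u.drop (u.length - s)) =
      pw μ s u * pw μ s (u.drop (u.length - s) ++ [a]) := by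
  induction u with
  | nil => simp; ring
  | cons b u ih =>
    rcases h.eq_or_lt with h | h
    · rw [← h]; simp; ring
    · rw [List.length_cons] at h
      have e : (b :: u).length - s = (u.length - s) + 1 := by simp; omega
      have h' : s ≤ u.length := by omega
      rw [e, List.drop_succ_cons, List.cons_append]
      simp only [pw]
      rw [List.take_append_of_le_length h']
      linear_combination (μ.real (cyl (b :: u.take s)) / μ.real (cyl (u.take s))) * ih h'

theorem exists_markov (hT : MeasurePreserving (shift m) μ μ) (hm : 0 < m) (s : ℕ) :
    ∃ ν : Measure (ℕ → Fin m), IsProbabilityMeasure ν ∧ MeasurePreserving (shift m) ν ν ∧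
      ∀ w, ν.real (cyl w) = pw μ s w := by
  obtain ⟨ν, hν, h⟩ := exists_measure_cyl (pw μ s) ⟨0, hm⟩ (pw_nonneg μ s) (pw_sum_snoc μ hT s)
    (by rw [pw])
  refine ⟨ν, hν, ⟨measurable_shift, ?_⟩, h⟩
  have : IsProbabilityMeasure (ν.map (shift m)) :=
    Measure.isProbabilityMeasure_map measurable_shift.aemeasurable
  refine ext_of_generate_finite _ (generateFrom_measurableCylinders (α := fun _ : ℕ => Fin m)).symm
    isPiSystem_measurableCylinders ?_ (by simp)
  intro A hA
  classical
  obtain ⟨N, S, rfl⟩ := cylinders_blk hA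
  rw [← measureReal_eq_measureReal_iff]
  have e : S = ((S.toFinset : Finset (Fin N → Fin m)) : Set (Fin N → Fin m)) := by simp
  rw [e, real_preimage_sum _ (FM_Blk N), real_preimage_sum _ (FM_Blk N)]
  refine Finset.sum_congr rfl fun w _ => ?_
  rw [← cyl_ofFn, map_measureReal_apply measurable_shift (measurableSet_cyl _),
    ← sum_cons_real_shift]
  simp only [h]
  exact pw_sum_cons μ hT s _

theorem hKS_markov_ge (hT : MeasurePreserving (shift m) μ μ) (s : ℕ) (ν : Measure (ℕ → Fin m)) [IsProbabilityMeasure ν]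
    (hν : MeasurePreserving (shift m) ν ν) (h : ∀ w, ν.real (cyl w) = pw μ s w) :
    hKS (shift m) μ ≤ hKS (shift m) ν := by
  refine (hKS_le μ hT s).trans (le_hKS ν hν _ ?_)
  have hB : ∀ n ≤ s + 1, Hent μ (Blk m n) = Hent ν (Blk m n) := by
    intro n hn
    unfold Hent
    refine Finset.sum_congr rfl fun w _ => ?_
    rw [← cyl_ofFn, h, pw_eq μ hT s _ (by simpa using hn)]
  rw [hB s (by omega), hB (s + 1) le_rfl]
  have hconst : ∀ j, Hent ν (Blk m (s + j + 1)) - Hent ν (Blk m (s + j)) =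
      Hent ν (Blk m (s + 1)) - Hent ν (Blk m s) := by
    intro j
    induction j with
    | zero => rfl
    | succ j ih =>
      obtain ⟨h1, h2, h3, h4⟩ := blk_idents ν hν (s + j)
      have := Hent_submod_eq ν (FM_eval 0)
        ((FM_Blk (s + j)).comp_right (measurable_shift (m := m)))
        (FM_eval (s + j + 1)) (by
          intro a w b
          have e0 : ν.real ((fun x => Blk m (s + j) (shift m x)) ⁻¹' {w}) =
              pw μ s (List.ofFn w) := by
            rw [← h, cyl_ofFn]
            exact hν.measureReal_preimage (FM_Blk _ _).nullMeasurableSet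
          have e1 : (fun x : ℕ → Fin m => (x 0, Blk m (s + j) (shift m x), x (s + j + 1))) ⁻¹'
              {(a, w, b)} = cyl (a :: (List.ofFn w ++ [b])) := by
            ext x
            rw [mem_cyl_cons, mem_cyl_snoc, mem_cyl_ofFn]
            simp [shift]
          have e2 : (fun x : ℕ → Fin m => (x 0, Blk m (s + j) (shift m x))) ⁻¹'
              {(a, w)} = cyl (a :: List.ofFn w) := by
            ext x
            rw [mem_cyl_cons, mem_cyl_ofFn]
            simp
          have e3 : ν.real ((fun x : ℕ → Fin m => (Blk m (s + j) (shift m x), x (s + j + 1))) ⁻¹'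
              {(w, b)}) = pw μ s (List.ofFn w ++ [b]) := by
            rw [← h, ← hν.measureReal_preimage (measurableSet_cyl _).nullMeasurableSet]
            congr 1
            ext x
            rw [Set.mem_preimage, Set.mem_preimage, mem_cyl_snoc, mem_cyl_ofFn]
            simp [shift]
          rw [e0, e1, e2, e3, h, h]
          exact pw_markov_short μ s a _ _ (by simp))
      rw [h1, h2, h3, h4] at this
      rw [← ih]
      change Hent ν (Blk m (s + j + 2)) - Hent ν (Blk m (s + j + 1)) = _
      linarith
  intro n
  have h1 := blk_incr_anti ν hν (show n ≤ s + n by omega)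
  simp only at h1
  rw [← hconst n]
  exact h1

end Weights

/-- For any shift-invariant Borel probability measure `μ` on `Σ_m` and
`k ≥ 1`, there is a `(k-1)`-step Markov measure `ν` agreeing with `μ` on all cylinders of
length `k` and with `h_ν ≥ h_μ`. -/
theorem exists_markov_measure_matching_cylinders_entropy_ge
    (m : ℕ) (hm : 2 ≤ m) (k : ℕ) (hk : 1 ≤ k)
    (μ : Measure (ℕ → Fin m)) (hprob : IsProbabilityMeasure μ)
    (hinv : MeasurePreserving (shift m) μ μ) :
    ∃ ν : Measure (ℕ → Fin m), IsProbabilityMeasure ν ∧ IsMarkovOfStep (k - 1) ν ∧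
      (∀ w : List (Fin m), w.length = k → ν (cyl w) = μ (cyl w)) ∧
      hKS (shift m) μ ≤ hKS (shift m) ν := by
  obtain ⟨ν, hν, hνinv, h⟩ := exists_markov μ hinv (by omega) (k - 1)
  have hE : ∀ w, ν (cyl w) = ENNReal.ofReal (pw μ (k - 1) w) := fun w => by
    rw [← h, ofReal_measureReal]
  refine ⟨ν, hν, ⟨hνinv, fun u a hu => ?_⟩, fun w hw => ?_,
    hKS_markov_ge μ hinv (k - 1) ν hνinv h⟩
  · simp only [hE]
    rw [← ENNReal.ofReal_mul (pw_nonneg _ _ _), ← ENNReal.ofReal_mul (pw_nonneg _ _ _),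
      pw_markov μ _ u a hu]
  · rw [hE, pw_eq μ hinv _ w (by omega), ofReal_measureReal]

end Shift
end

section
/- Let (Σ_m, σ) be the full shift, r ≥ 1, and Φ(x^{(1)},…,x^{(r)}) = φ_1(x^{(1)}_1) ⋯ φ_r(x^{(r)}_1) where each φ_k : {0,…,m−1} → ℝ. Then E_Φ(α) ≠ ∅ if and only if α = A(p) for some probability vector p = (p_0,…,p_{m−1}), where A(p) = Π_{k=1}^r Σ_{j=0}^{m−1} φ_k(j) p_j. -/
open MeasureTheory Filter Topology
open scoped ENNReal NNReal

section Shift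

/- The metric `d(x,y) = (1/2)^{min {n : x_n ≠ y_n}}` on the symbolic space
`Σ_m = {0, …, m-1}^ℕ`; its topology is the product topology. -/
attribute [local instance] PiNat.metricSpace

/-- The V-statistic of a product kernel factorizes. -/
lemma Vstat_prod_aux (m r : ℕ) (φ : Fin r → Fin m → ℝ) (n : ℕ) (x : ℕ → Fin m) :
    Vstat (shift m) (fun x : Fin r → (ℕ → Fin m) => ∏ k : Fin r, φ k (x k 0)) n x
      = ∏ k : Fin r, ((∑ i : Fin n, φ k (x ((i : ℕ) + 1))) / (n : ℝ)) := by
  have hs : ∀ (a b : ℕ) (y : ℕ → Fin m), ((shift m)^[a] y) b = y (b + a) := by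
    intro a
    induction a with
    | zero => intro b y; rfl
    | succ a ih =>
      intro b y
      rw [Function.iterate_succ_apply, ih]
      simp only [shift]
      congr 1
  unfold Vstat
  rw [Finset.prod_div_distrib, Finset.prod_univ_sum, Finset.prod_const, Finset.card_univ,
    Fintype.card_fin, Fintype.piFinset_univ]
  simp only [hs, zero_add]

/-- Empirical frequency of the symbol `j`. -/
noncomputable def empFreq {m : ℕ} (x : ℕ → Fin m) (n : ℕ) (j : Fin m) : ℝ :=
  (∑ i : Fin n, if x ((i : ℕ) + 1) = j then (1 : ℝ) else 0) / (n : ℝ)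

lemma empFreq_mem {m : ℕ} (x : ℕ → Fin m) (n : ℕ) : empFreq x (n + 1) ∈ stdSimplex ℝ (Fin m) := by
  refine ⟨fun j => ?_, ?_⟩
  · unfold empFreq
    refine div_nonneg (Finset.sum_nonneg fun i _ => ?_) (by positivity)
    split_ifs <;> norm_num
  · unfold empFreq
    rw [← Finset.sum_div, Finset.sum_comm]
    have : ((n : ℝ) + 1) ≠ 0 := by positivity
    simp [this]

lemma avg_eq_empFreq {m : ℕ} (x : ℕ → Fin m) (f : Fin m → ℝ) (n : ℕ) :
    (∑ i : Fin n, f (x ((i : ℕ) + 1))) / (n : ℝ) = ∑ j : Fin m, f j * empFreq x n j := by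
  unfold empFreq
  simp only [mul_div_assoc', Finset.mul_sum]
  rw [← Finset.sum_div, Finset.sum_comm]
  simp

/-- A greedy choice produces a sequence with prescribed frequencies. -/
lemma exists_seq_empFreq {m : ℕ} (p : Fin m → ℝ) (hp : ∀ j, 0 ≤ p j) (hs : ∑ j, p j = 1) :
    ∃ x : ℕ → Fin m, Tendsto (empFreq x) atTop (𝓝 p) := by
  have hc : ∀ D : Fin m → ℝ, ∃ c : Fin m, ∑ j, D j = 0 → 0 < D c + p c := by
    intro D
    by_cases hD : ∑ j, D j = 0
    · have h1 : (0 : ℝ) < ∑ j, (D j + p j) := by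
        rw [Finset.sum_add_distrib, hD, hs]; norm_num
      obtain ⟨c, -, hc⟩ := Finset.exists_lt_of_sum_lt (s := Finset.univ) (f := fun _ : Fin m => (0 : ℝ))
        (g := fun j => D j + p j) (by simpa using h1)
      exact ⟨c, fun _ => hc⟩
    · have hm : Nonempty (Fin m) := by
        by_contra h
        rw [not_nonempty_iff] at h
        simp at hs
      exact ⟨hm.some, fun h => absurd h hD⟩
  choose c hc using hc
  let D : ℕ → Fin m → ℝ := fun n => Nat.rec (fun _ => 0)
    (fun _ D j => D j + p j - if c D = j then 1 else 0) n
  have hD0 : ∀ j, D 0 j = 0 := fun j => rfl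
  have hDs : ∀ n j, D (n + 1) j = D n j + p j - if c (D n) = j then 1 else 0 := fun n j => rfl
  have hsum : ∀ n, ∑ j, D n j = 0 := by
    intro n
    induction n with
    | zero => simp [hD0]
    | succ n ih =>
      simp only [hDs, Finset.sum_sub_distrib, Finset.sum_add_distrib, ih, hs]
      simp
  have hlow : ∀ n j, -1 ≤ D n j := by
    intro n
    induction n with
    | zero => intro j; rw [hD0]; norm_num
    | succ n ih =>
      intro j
      rw [hDs]
      split_ifs with h
      · have := hc (D n) (hsum n)
        rw [h] at this
        linarith
      · linarith [ih j, hp j]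
  have hup : ∀ n j, D n j ≤ m := by
    intro n j
    have h1 : D n j + 1 ≤ ∑ i, (D n i + 1) :=
      Finset.single_le_sum (f := fun i => D n i + 1)
        (fun i _ => by linarith [hlow n i]) (Finset.mem_univ j)
    rw [Finset.sum_add_distrib, hsum] at h1
    simp at h1
    linarith
  refine ⟨fun n => c (D (n - 1)), ?_⟩
  rw [tendsto_pi_nhds]
  intro j
  have hcount : ∀ n : ℕ, (∑ i : Fin n, if c (D ((i : ℕ) + 1 - 1)) = j then (1 : ℝ) else 0)
      = n * p j - D n j := by
    intro n
    induction n with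
    | zero => simp [hD0]
    | succ n ih =>
      rw [Fin.sum_univ_castSucc]
      simp only [Nat.add_sub_cancel] at ih
      simp only [Fin.val_castSucc, Fin.val_last, ih, hDs, Nat.add_sub_cancel]
      push_cast
      ring
  have hz : Tendsto (fun n : ℕ => D n j / (n : ℝ)) atTop (𝓝 0) := by
    refine squeeze_zero_norm (a := fun n : ℕ => ((m : ℝ) + 1) / n) (fun n => ?_)
      (tendsto_const_div_atTop_nhds_zero_nat _)
    rw [norm_div, Real.norm_natCast]
    refine div_le_div_of_nonneg_right ?_ (by positivity)
    rw [Real.norm_eq_abs, abs_le]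
    have : (0 : ℝ) ≤ m := by positivity
    constructor <;> linarith [hlow n j, hup n j]
  have hl : Tendsto (fun n : ℕ => p j - D n j / (n : ℝ)) atTop (𝓝 (p j)) := by
    simpa using hz.const_sub (p j)
  refine hl.congr' ?_
  filter_upwards [eventually_gt_atTop 0] with n hn
  have : (n : ℝ) ≠ 0 := by positivity
  unfold empFreq
  rw [hcount]
  field_simp

/-- On the full shift `(Σ_m, σ)`, for a kernel
`Φ(x⁽¹⁾, …, x⁽ʳ⁾) = φ_1(x⁽¹⁾_1) ⋯ φ_r(x⁽ʳ⁾_1)`: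
`E_Φ(α) ≠ ∅` iff `α = A(p) = ∏_k ∑_j φ_k(j) p_j` for some probability vector `p`. -/
theorem Eset_nonempty_iff_exists_probability_vector
    (m : ℕ) (hm : 2 ≤ m) (r : ℕ) (hr : 1 ≤ r)
    (φ : Fin r → Fin m → ℝ)
    (Φ : (Fin r → (ℕ → Fin m)) → ℝ)
    (hΦ : Φ = fun x => ∏ k : Fin r, φ k (x k 0)) (α : ℝ) :
    (Eset (shift m) Φ α).Nonempty ↔
      ∃ p : Fin m → ℝ, (∀ j, 0 ≤ p j) ∧ ∑ j, p j = 1 ∧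
        α = ∏ k : Fin r, ∑ j : Fin m, φ k j * p j := by
  subst hΦ
  have hV : ∀ (x : ℕ → Fin m) (n : ℕ),
      Vstat (shift m) (fun x : Fin r → (ℕ → Fin m) => ∏ k : Fin r, φ k (x k 0)) n x
        = ∏ k : Fin r, ∑ j : Fin m, φ k j * empFreq x n j := by
    intro x n
    rw [Vstat_prod_aux]
    exact Finset.prod_congr rfl fun k _ => avg_eq_empFreq x (φ k) n
  have hA : Continuous fun p : Fin m → ℝ => ∏ k : Fin r, ∑ j : Fin m, φ k j * p j := by
    fun_prop
  constructor
  · rintro ⟨x, hx⟩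
    simp only [Eset, Set.mem_setOf_eq, hV] at hx
    obtain ⟨p, hp, s, hs, hlim⟩ := (isCompact_stdSimplex ℝ (Fin m)).tendsto_subseq
      (fun n => empFreq_mem x n)
    refine ⟨p, hp.1, hp.2, ?_⟩
    have h1 := (hx.comp (tendsto_add_atTop_nat 1)).comp hs.tendsto_atTop
    exact tendsto_nhds_unique h1 ((hA.tendsto p).comp hlim)
  · rintro ⟨p, hp, hs, rfl⟩
    obtain ⟨x, hx⟩ := exists_seq_empFreq p hp hs
    refine ⟨x, ?_⟩
    simp only [Eset, Set.mem_setOf_eq, hV]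
    exact (hA.tendsto p).comp hx

end Shift
end
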